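/- Let α = μ + 1 be a successor ordinal and let T be a tree with rk(T) = α and T^{(α)} = ∅. Then: (i) for every t ∈ T, rk(T_t) = rk(T_t ∪ {s : s ≼ t}); (ii) the tree H = {t ∈ T : rk(T_t) = α} belongs to I_d. -/

import Mathlib

open Set

/-- The orthogonal of a family of sets: all sets having finite intersection
with every member of the family. -/
def orth {X : Type*} (I : Set (Set X)) : Set (Set X) :=
  {B | ∀ A ∈ I, (A ∩ B).Finite}

/-- `I` is an ideal on `X`: contains `∅`, closed under subsets and finite unions
(the improper ideal `𝒫 X` is allowed). -/
def IsIdealOn {X : Type*} (I : Set (Set X)) : Prop :=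
  ∅ ∈ I ∧ (∀ A ∈ I, ∀ B ⊆ A, B ∈ I) ∧ (∀ A ∈ I, ∀ B ∈ I, A ∪ B ∈ I)

/-- An ideal is Fréchet if it equals its double orthogonal. -/
def IsFrechet {X : Type*} (I : Set (Set X)) : Prop := orth (orth I) = I

/-- Isomorphism of ideals: a bijection of the underlying sets such that
`A ∈ I ↔ f '' A ∈ J`. -/
def IdealIso {X Y : Type*} (I : Set (Set X)) (J : Set (Set Y)) : Prop :=
  ∃ f : X ≃ Y, ∀ A : Set X, A ∈ I ↔ f '' A ∈ J

/-- Isomorphic embedding of ideals: an injection of the underlying sets such that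
`A ∈ I ↔ f '' A ∈ J`. -/
def IdealEmbeds {X Y : Type*} (I : Set (Set X)) (J : Set (Set Y)) : Prop :=
  ∃ f : X → Y, Function.Injective f ∧ ∀ A : Set X, A ∈ I ↔ f '' A ∈ J

/-- The restriction `I ↾ K` of an ideal on `X` to a subset `K ⊆ X`,
viewed as an ideal on the subtype `↥K`. -/
def restrictIdeal {X : Type*} (I : Set (Set X)) (K : Set X) : Set (Set ↥K) :=
  {A | (Subtype.val '' A : Set X) ∈ I}

/-- `FIN`, the ideal of finite subsets of `ℕ`. -/
def finIdeal : Set (Set ℕ) := {A | A.Finite}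

/-- Countable direct sum of ideals on `ℕ`, realized on `ℕ` via the pairing
bijection `ℕ × ℕ ≃ ℕ`: the `n`-th block is `{Nat.pair n m : m ∈ ℕ}`. -/
def directSumN (I : ℕ → Set (Set ℕ)) : Set (Set ℕ) :=
  {A | ∀ n, {m | Nat.pair n m ∈ A} ∈ I n}

/-- Finite direct sum `I 0 ⊕ ⋯ ⊕ I k` of ideals on `ℕ`, realized on `ℕ` using
the partition of `ℕ` into residue classes mod `k + 1`. -/
def finSumN (k : ℕ) (I : ℕ → Set (Set ℕ)) : Set (Set ℕ) :=
  {A | ∀ i ≤ k, {m | m * (k + 1) + i ∈ A} ∈ I i}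

/-- Binary direct sum of ideals on `ℕ`, realized on `ℕ` via evens and odds. -/
def sum2 (I J : Set (Set ℕ)) : Set (Set ℕ) :=
  {A | {m | 2 * m ∈ A} ∈ I ∧ {m | 2 * m + 1 ∈ A} ∈ J}

/-- All countable direct sums of members of `U`. -/
def sumsOf (U : Set (Set (Set ℕ))) : Set (Set (Set ℕ)) :=
  {J | ∃ I : ℕ → Set (Set ℕ), (∀ n, I n ∈ U) ∧ J = directSumN I}

/-- `ℬ_α^{⊕⊥}`: countable direct sums of members of `U` together with their
orthogonals. -/
def sumsPerpOf (U : Set (Set (Set ℕ))) : Set (Set (Set ℕ)) :=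
  sumsOf U ∪ {J | ∃ I ∈ sumsOf U, J = orth I}

/-- `ℬ_α`: finite direct sums of members of `ℬ_α^{⊕⊥}`. -/
def BstepOf (U : Set (Set (Set ℕ))) : Set (Set (Set ℕ)) :=
  {J | ∃ k, ∃ I : ℕ → Set (Set ℕ), (∀ i ≤ k, I i ∈ sumsPerpOf U) ∧ J = finSumN k I}

/-- The hierarchy `ℬ_α`: `ℬ₀ = {𝒫(ℕ), FIN, 𝒫(ℕ) ⊕ FIN}` and, for `α > 0`,
`ℬ_α` consists of the finite direct sums of countable direct sums of members of
`⋃_{ξ<α} ℬ_ξ` and of orthogonals of such countable sums. -/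
noncomputable def Bfam : Ordinal.{0} → Set (Set (Set ℕ)) :=
  WellFounded.fix wellFounded_lt fun α ih =>
    if α = 0 then {(Set.univ : Set (Set ℕ)), finIdeal, sum2 Set.univ finIdeal}
    else BstepOf {I | ∃ ξ, ∃ h : ξ < α, I ∈ ih ξ h}

/-- The first uncountable ordinal `ω₁`. -/
noncomputable def omega1 : Ordinal.{0} := (Cardinal.aleph 1).ord

/-- An ideal (on any countable set) belongs to `ℬ = ⋃_{α<ω₁} ℬ_α`
(membership in `ℬ` is understood up to isomorphism). -/
def InB {X : Type*} (I : Set (Set X)) : Prop :=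
  ∃ α, α < omega1 ∧ ∃ J ∈ Bfam α, IdealIso I J

/-- The ideals `P_α`: `P₀ = 𝒫(ℕ)`, `P_{α+1} = (P_α⊥)^ω`, and for limit `α`,
`P_α = ⊕ₙ P_{v α n}⊥` where `v α` is a fixed increasing sequence with supremum `α`. -/
noncomputable def Pfam (v : Ordinal.{0} → ℕ → Ordinal.{0}) : Ordinal.{0} → Set (Set ℕ) :=
  fun α => @Ordinal.limitRecOn (fun _ => Set (Set ℕ)) α
    (Set.univ : Set (Set ℕ))
    (fun _ P => directSumN fun _ => orth P)
    (fun β _ ih => directSumN fun n =>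
      if h : v β n < β then orth (ih (v β n) h) else ∅)

/-- The subset of the Cantor cube `2^X` corresponding to a family of subsets of `X`. -/
def idealSet {X : Type*} (I : Set (Set X)) : Set (X → Bool) := {f | {x | f x = true} ∈ I}

/-- An ideal is Borel if the corresponding subset of the Cantor cube `2^X` is Borel. -/
def IsBorelIdeal {X : Type*} (I : Set (Set X)) : Prop := MeasurableSet (idealSet I)

/-- A subset of the Cantor cube is `F_σδ` if it is a countable intersection of
countable unions of closed sets. -/
def IsFsd {X : Type*} (S : Set (X → Bool)) : Prop :=
  ∃ C : ℕ → ℕ → Set (X → Bool), (∀ n m, IsClosed (C n m)) ∧ S = ⋂ n, ⋃ m, C n m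

/-- The tree `⟨A⟩` generated by `A ⊆ ℕ^{<ω}`: all prefixes of members of `A`. -/
def genTree (A : Set (List ℕ)) : Set (List ℕ) := {t | ∃ a ∈ A, t <+: a}

/-- The ideal `I_wf` on `ℕ^{<ω}` of well founded sets: those `A` such that no
`α ∈ ℕ^ω` has all of its finite initial segments in `⟨A⟩`. -/
def Iwf : Set (Set (List ℕ)) :=
  {A | ¬ ∃ α : ℕ → ℕ, ∀ n, (List.ofFn fun i : Fin n => α i) ∈ genTree A}

/-- The ideal `I_d = I_wf⊥` on `ℕ^{<ω}` of sets dominated by a branch. -/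
def Idom : Set (Set (List ℕ)) :=
  {A | ∃ α : ℕ → ℕ, ∀ s ∈ A, ∀ i : Fin s.length, s.get i ≤ α i.1}

/-- `𝒩_t`, the set of extensions of `t` in `ℕ^{<ω}`. -/
def Nbhd (t : List ℕ) : Set (List ℕ) := {s | t <+: s}

/-- Direct sum of a sequence of ideals `I n` on sets `X n`, as an ideal on the
disjoint union `Σ n, X n` (the partition into the fibers). -/
def sigmaSum {X : ℕ → Type*} (I : ∀ n, Set (Set (X n))) : Set (Set (Σ n, X n)) :=
  {A | ∀ n, {x | (⟨n, x⟩ : Σ n, X n) ∈ A} ∈ I n}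

/-- Binary direct sum of ideals on `X` and `Y`, as an ideal on `X ⊕ Y`. -/
def sumIdeal2 {X Y : Type*} (I : Set (Set X)) (J : Set (Set Y)) : Set (Set (X ⊕ Y)) :=
  {A | (Sum.inl ⁻¹' A) ∈ I ∧ (Sum.inr ⁻¹' A) ∈ J}

/-- A tree on `ℕ`: a subset of `ℕ^{<ω}` downward closed under the prefix order. -/
def IsTree (T : Set (List ℕ)) : Prop := ∀ s ∈ T, ∀ t, t <+: s → t ∈ T

/-- `A_a = {s ∈ A : a ≼ s}`. -/
def subAt (A : Set (List ℕ)) (a : List ℕ) : Set (List ℕ) := {s ∈ A | a <+: s}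

/-- The derivative `A' = {a ∈ A : A_a ∉ I_d}`. -/
def derivD (A : Set (List ℕ)) : Set (List ℕ) := {a ∈ A | subAt A a ∉ Idom}

/-- The iterated derivative `A^{(α)}`. -/
noncomputable def derivIter (A : Set (List ℕ)) : Ordinal.{0} → Set (List ℕ) :=
  fun α => @Ordinal.limitRecOn (fun _ => Set (List ℕ)) α
    A (fun _ S => derivD S) (fun β _ ih => ⋂ ξ, ⋂ h : ξ < β, ih ξ h)

/-- The rank of `A`: the least `α` with `A^{(α)} = A^{(α+1)}`. -/
noncomputable def rkD (A : Set (List ℕ)) : Ordinal.{0} :=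
  sInf {α | derivIter A α = derivIter A (α + 1)}

/-- The ideal `WO(ℚ)` of well ordered (equivalently, well founded) subsets of `ℚ`. -/
def WOideal : Set (Set ℚ) := {A | A.IsWF}

/-- A subset of `ℚ` is scattered if `ℚ` does not order-embed into it. -/
def Scattered (A : Set ℚ) : Prop := ¬ ∃ f : ℚ → ℚ, (∀ q, f q ∈ A) ∧ StrictMono f

/-- The dual filter of an ideal on `ℕ`. -/
def dualFilter (I : Set (Set ℕ)) : Set (Set ℕ) := {A | Aᶜ ∈ I}

/-- `U` is open in the topology `τ_F` on `ℕ^{<ω}` determined by the filter `F`. -/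
def isTauOpen (F : Set (Set ℕ)) (U : Set (List ℕ)) : Prop :=
  ∀ s ∈ U, {n | s ++ [n] ∈ U} ∈ F


theorem Idom_mono {A B : Set (List ℕ)} (hB : B ∈ Idom) (h : A ⊆ B) : A ∈ Idom := by
  obtain ⟨f, hf⟩ := hB
  exact ⟨f, fun s hs => hf s (h hs)⟩

theorem Idom_union {A B : Set (List ℕ)} (hA : A ∈ Idom) (hB : B ∈ Idom) : A ∪ B ∈ Idom := by
  obtain ⟨f, hf⟩ := hA
  obtain ⟨g, hg⟩ := hB
  refine ⟨fun n => max (f n) (g n), ?_⟩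
  rintro s (hs | hs) i
  · exact (hf s hs i).trans (le_max_left _ _)
  · exact (hg s hs i).trans (le_max_right _ _)

theorem prefixes_mem_Idom (t : List ℕ) : {s | s <+: t} ∈ Idom := by
  refine ⟨fun n => t.getD n 0, ?_⟩
  rintro s ⟨u, rfl⟩ i
  simp [List.getD_eq_getElem?_getD, List.getElem?_append_left i.2]

theorem derivIter_zero (A : Set (List ℕ)) : derivIter A 0 = A :=
  Ordinal.limitRecOn_zero ..

theorem derivIter_add_one (A : Set (List ℕ)) (β : Ordinal.{0}) :
    derivIter A (β + 1) = derivD (derivIter A β) :=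
  Ordinal.limitRecOn_add_one ..

theorem derivIter_limit (A : Set (List ℕ)) {β : Ordinal.{0}} (hβ : Order.IsSuccLimit β) :
    derivIter A β = ⋂ ξ, ⋂ _ : ξ < β, derivIter A ξ :=
  Ordinal.limitRecOn_limit (motive := fun _ => Set (List ℕ)) _ _ _ _ hβ

theorem mem_derivIter_limit {A : Set (List ℕ)} {β : Ordinal.{0}} (hβ : Order.IsSuccLimit β)
    {s : List ℕ} : s ∈ derivIter A β ↔ ∀ ξ < β, s ∈ derivIter A ξ := by
  simp [derivIter_limit A hβ]

theorem derivD_subset (A : Set (List ℕ)) : derivD A ⊆ A := fun _ h => h.1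

theorem derivD_empty : derivD ∅ = ∅ := subset_empty_iff.1 (derivD_subset ∅)

theorem derivD_eq_empty {A : Set (List ℕ)} (hA : A ∈ Idom) : derivD A = ∅ :=
  eq_empty_of_forall_notMem fun _ h => h.2 (Idom_mono hA fun _ hs => hs.1)

theorem derivIter_antitone (A : Set (List ℕ)) : Antitone (derivIter A) := by
  intro γ β
  induction β using Ordinal.limitRecOn with
  | zero =>
    intro h
    rw [nonpos_iff_eq_zero.1 h]
  | add_one β ih =>
    intro h
    rcases h.eq_or_lt with rfl | h
    · exact le_rfl
    · rw [derivIter_add_one]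
      exact (derivD_subset _).trans (ih (Order.lt_add_one_iff.1 h))
  | limit β hβ ih =>
    intro h
    rcases h.eq_or_lt with rfl | h
    · exact le_rfl
    · exact fun s hs => (mem_derivIter_limit hβ).1 hs γ h

theorem derivIter_subset (A : Set (List ℕ)) (β : Ordinal.{0}) : derivIter A β ⊆ A := by
  simpa only [derivIter_zero] using derivIter_antitone A (zero_le : 0 ≤ β)

theorem subset_derivIter_of_stable {A : Set (List ℕ)} {β : Ordinal.{0}}
    (h : derivIter A β = derivIter A (β + 1)) (γ : Ordinal.{0}) :
    derivIter A β ⊆ derivIter A γ := by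
  induction γ using Ordinal.limitRecOn with
  | zero => simpa only [derivIter_zero] using derivIter_subset A β
  | add_one γ ih =>
    rcases le_total γ β with hγ | hγ
    · rw [h]
      exact derivIter_antitone A (by gcongr)
    · rw [derivIter_add_one, ← ih.antisymm (derivIter_antitone A hγ), ← derivIter_add_one, ← h]
  | limit γ hγ ih => exact fun s hs => (mem_derivIter_limit hγ).2 fun ξ hξ => ih ξ hξ hs

/-- If some iterated derivative vanishes, the rank is the first stage where this happens. -/
theorem rkD_eq_sInf_empty {A : Set (List ℕ)} {γ : Ordinal.{0}} (h : derivIter A γ = ∅) :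
    rkD A = sInf {β | derivIter A β = ∅} := by
  unfold rkD
  congr 1
  ext β
  constructor
  · intro hβ
    exact subset_empty_iff.1 (h ▸ subset_derivIter_of_stable hβ γ)
  · intro hβ
    change derivIter A β = ∅ at hβ
    change derivIter A β = derivIter A (β + 1)
    rw [derivIter_add_one, hβ, derivD_empty]

theorem subAt_subAt {A : Set (List ℕ)} {t a : List ℕ} (h : t <+: a) :
    subAt (subAt A t) a = subAt A a := by
  ext s
  exact ⟨fun hs => ⟨hs.1.1, hs.2⟩, fun hs => ⟨⟨hs.1, h.trans hs.2⟩, hs.2⟩⟩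

theorem derivD_subAt (A : Set (List ℕ)) (t : List ℕ) :
    derivD (subAt A t) = subAt (derivD A) t := by
  ext a
  constructor
  · rintro ⟨⟨ha, hta⟩, h⟩
    exact ⟨⟨ha, subAt_subAt (A := A) hta ▸ h⟩, hta⟩
  · rintro ⟨⟨ha, h⟩, hta⟩
    exact ⟨⟨ha, hta⟩, (subAt_subAt (A := A) hta).symm ▸ h⟩

theorem derivIter_subAt (A : Set (List ℕ)) (t : List ℕ) (β : Ordinal.{0}) :
    derivIter (subAt A t) β = subAt (derivIter A β) t := by
  induction β using Ordinal.limitRecOn with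
  | zero => simp only [derivIter_zero]
  | add_one β ih => rw [derivIter_add_one, derivIter_add_one, ih, derivD_subAt]
  | limit β hβ ih =>
    ext s
    rw [mem_derivIter_limit hβ]
    constructor
    · intro h
      refine ⟨(mem_derivIter_limit hβ).2 fun ξ hξ => ?_, (derivIter_subset _ 0 (h 0 hβ.bot_lt)).2⟩
      have hs := h ξ hξ
      rw [ih ξ hξ] at hs
      exact hs.1
    · rintro ⟨h, hts⟩ ξ hξ
      rw [ih ξ hξ]
      exact ⟨(mem_derivIter_limit hβ).1 h ξ hξ, hts⟩

theorem IsTree.derivD {T : Set (List ℕ)} (hT : IsTree T) : IsTree (derivD T) :=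
  fun s hs t hts => ⟨hT s hs.1 t hts, fun h => hs.2 (Idom_mono h
    fun _ hu => ⟨hu.1, hts.trans hu.2⟩)⟩

theorem IsTree.derivIter {T : Set (List ℕ)} (hT : IsTree T) (β : Ordinal.{0}) :
    IsTree (derivIter T β) := by
  induction β using Ordinal.limitRecOn with
  | zero => rwa [derivIter_zero]
  | add_one β ih =>
    rw [derivIter_add_one]
    exact ih.derivD
  | limit β hβ ih =>
    intro s hs t hts
    exact (mem_derivIter_limit hβ).2 fun ξ hξ =>
      ih ξ hξ s ((mem_derivIter_limit hβ).1 hs ξ hξ) t hts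

theorem subAt_union_prefixes {T : Set (List ℕ)} {t : List ℕ} (ht : t ∈ T) :
    subAt (subAt T t ∪ {s | s <+: t}) t = subAt T t := by
  ext s
  constructor
  · rintro ⟨hs | hs, hts⟩
    · exact hs
    · rw [List.IsPrefix.eq_of_length_le hs hts.length_le]
      exact ⟨ht, List.prefix_rfl⟩
  · exact fun hs => ⟨Or.inl hs, hs.2⟩

theorem derivIter_union_prefixes_subset {T : Set (List ℕ)} {t : List ℕ} (ht : t ∈ T)
    (β : Ordinal.{0}) :
    derivIter (subAt T t ∪ {s | s <+: t}) β ⊆ derivIter (subAt T t) β ∪ {s | s <+: t} := by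
  intro s hs
  rcases derivIter_subset _ β hs with h | h
  · left
    rw [← subAt_union_prefixes ht, derivIter_subAt]
    exact ⟨hs, h.2⟩
  · exact Or.inr h

theorem derivIter_union_prefixes_eq_empty {T : Set (List ℕ)} {t : List ℕ} (ht : t ∈ T)
    {β : Ordinal.{0}} (h : t ∉ derivIter (subAt T t) β) :
    derivIter (subAt T t ∪ {s | s <+: t}) β = ∅ := by
  induction β using Ordinal.limitRecOn with
  | zero =>
    rw [derivIter_zero] at h
    exact absurd ⟨ht, List.prefix_rfl⟩ h
  | add_one β ih =>
    rw [derivIter_add_one]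
    by_cases htβ : t ∈ derivIter (subAt T t) β
    · have hdom : derivIter (subAt T t) β ∈ Idom := by
        by_contra hnot
        rw [derivIter_add_one] at h
        refine h ⟨htβ, fun hd => hnot (Idom_mono hd fun s hs => ⟨hs, ?_⟩)⟩
        exact (derivIter_subset _ β hs).2
      exact derivD_eq_empty (Idom_mono (Idom_union hdom (prefixes_mem_Idom t))
        (derivIter_union_prefixes_subset ht β))
    · rw [ih htβ, derivD_empty]
  | limit β hβ ih =>
    rw [mem_derivIter_limit hβ] at h
    push Not at h
    obtain ⟨ξ, hξ, htξ⟩ := h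
    exact subset_empty_iff.1 (ih ξ hξ htξ ▸ derivIter_antitone _ hξ.le)

theorem derivIter_union_prefixes_eq_empty_iff {T : Set (List ℕ)} {t : List ℕ} (ht : t ∈ T)
    (β : Ordinal.{0}) :
    derivIter (subAt T t ∪ {s | s <+: t}) β = ∅ ↔ derivIter (subAt T t) β = ∅ := by
  constructor
  · intro h
    rw [← subAt_union_prefixes ht, derivIter_subAt, h]
    exact eq_empty_of_forall_notMem fun _ hs => hs.1
  · exact fun h => derivIter_union_prefixes_eq_empty ht (h ▸ notMem_empty t)

theorem IsTree.mem_Idom_of_derivD_eq_empty {T : Set (List ℕ)} (hT : IsTree T)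
    (h : _root_.derivD T = ∅) : T ∈ Idom := by
  rcases T.eq_empty_or_nonempty with rfl | ⟨s, hs⟩
  · exact ⟨0, fun s hs => hs.elim⟩
  · by_contra hnot
    have hroot : [] ∈ _root_.derivD T :=
      ⟨hT s hs [] List.nil_prefix, fun hd =>
        hnot (Idom_mono hd fun u hu => ⟨hu, List.nil_prefix⟩)⟩
    exact notMem_empty _ (h ▸ hroot)

/-- Lemma 5.4: let `α = μ + 1` and `T` a tree with `rk(T) = α` and `T^{(α)} = ∅`.
Then (i) `rk(T_t) = rk(T_t ∪ {s : s ≼ t})` for every `t ∈ T`, and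
(ii) the tree `H = {t ∈ T : rk(T_t) = α}` belongs to `I_d`. -/
theorem stmt12 (μ : Ordinal.{0}) (T : Set (List ℕ)) (hT : IsTree T)
    (hrk : rkD T = μ + 1) (hempty : derivIter T (μ + 1) = ∅) :
    (∀ t ∈ T, rkD (subAt T t) = rkD (subAt T t ∪ {s | s <+: t})) ∧
    {t ∈ T | rkD (subAt T t) = μ + 1} ∈ Idom := by
  have hsub : ∀ t, derivIter (subAt T t) (μ + 1) = ∅ := by
    intro t
    rw [derivIter_subAt, hempty]
    exact eq_empty_of_forall_notMem fun _ hs => hs.1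
  constructor
  · intro t ht
    rw [rkD_eq_sInf_empty (hsub t),
      rkD_eq_sInf_empty ((derivIter_union_prefixes_eq_empty_iff ht _).2 (hsub t))]
    simp only [derivIter_union_prefixes_eq_empty_iff ht]
  · rw [derivIter_add_one] at hempty
    refine Idom_mono ((hT.derivIter μ).mem_Idom_of_derivD_eq_empty hempty) ?_
    rintro t ⟨-, hrt⟩
    rw [rkD_eq_sInf_empty (hsub t)] at hrt
    have hne : (derivIter (subAt T t) μ).Nonempty := by
      rw [nonempty_iff_ne_empty]
      intro he
      exact (lt_add_one μ).not_ge (hrt ▸ csInf_le' he)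
    rw [derivIter_subAt] at hne
    obtain ⟨s, hs, hts⟩ := hne
    exact hT.derivIter μ s hs t hts
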